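/- Let (A, X, I) be a formal context with X finite, let c be a finite nonempty index set of agents with mass functions m_j (j ∈ c) on X, and let ◇c and ▷c be the combined agendas defined by (◇c)(Y) := Σ_{(Z_j)_{j∈c} : ⋂_j Z_j = Y} Π_{j∈c} m_j(Z_j) and (▷c)(Y) := Σ_{(Z_j)_{j∈c} : ⋃_j Z_j = Y} Π_{j∈c} m_j(Z_j). Then for every agent j ∈ c and every β ∈ [0,1], 𝒞(◇c, β) ⊆ 𝒞(m_j, β) ⊆ 𝒞(▷c, β). -/

import Mathlib

open scoped Classical

noncomputable section

/-- In a formal context `(A, X, I)` (with `I ⊆ A × X`), a set `B ⊆ A` is a `Y`-extent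
(for `Y ⊆ X`) if `B = {a | ∀ x ∈ Y', (a, x) ∈ I}` for some `Y' ⊆ Y`. -/
def IsExtent {A X : Type*} (I : Set (A × X)) (Y : Set X) (B : Set A) : Prop :=
  ∃ Y' ⊆ Y, B = {a : A | ∀ x ∈ Y', (a, x) ∈ I}

/-- A (Dempster-Shafer) mass function on a finite set `X`:
a map `𝒫(X) → [0,1]` whose values sum to `1`. -/
def IsMass {X : Type*} [Fintype X] (m : Finset X → ℝ) : Prop :=
  (∀ Y : Finset X, 0 ≤ m Y ∧ m Y ≤ 1) ∧ ∑ Y : Finset X, m Y = 1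

/-- The stability index `ρ_m(G) = Σ_{Y ⊆ X, G is a Y-extent} m(Y)`. -/
def stabilityIndex {A X : Type*} [Fintype X] (I : Set (A × X)) (m : Finset X → ℝ)
    (G : Set A) : ℝ :=
  ∑ Y : Finset X, if IsExtent I (Y : Set X) G then m Y else 0

/-- `𝒞(m, β)`: the sets `G ⊆ A` which are `Y`-extents for some `Y ⊆ X` and
whose stability index is at least `β`. -/
def Csys {A X : Type*} [Fintype X] (I : Set (A × X)) (m : Finset X → ℝ) (β : ℝ) :
    Set (Set A) :=
  {G | (∃ Y : Set X, IsExtent I Y G) ∧ β ≤ stabilityIndex I m G}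

/-- `𝕃(m, β)`: all intersections of (possibly empty) subfamilies of `𝒞(m, β)`. -/
def Lsys {A X : Type*} [Fintype X] (I : Set (A × X)) (m : Finset X → ℝ) (β : ℝ) :
    Set (Set A) :=
  {L | ∃ 𝒢 ⊆ Csys I m β, L = ⋂₀ 𝒢}

/-- A family `𝒱 ⊆ 𝒫(X)` is upward closed w.r.t. inclusion. -/
def UpwardClosed {X : Type*} (𝒱 : Finset (Finset X)) : Prop :=
  ∀ Y ∈ 𝒱, ∀ Z : Finset X, Y ⊆ Z → Z ∈ 𝒱

/-- The upward restricted order `m₁ ≤_↑ m₂`. -/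
def UpOrder {X : Type*} [Fintype X] (m₁ m₂ : Finset X → ℝ) : Prop :=
  ∀ 𝒱 : Finset (Finset X), UpwardClosed 𝒱 →
    ∑ Y ∈ 𝒱, m₁ Y ≤ ∑ Y ∈ 𝒱, m₂ Y

/-- `S` is a specialization matrix witnessing `m₁ ≤_s m₂`. -/
def IsSpecMatrix {X : Type*} [Fintype X] (S : Finset X → Finset X → ℝ)
    (m₁ m₂ : Finset X → ℝ) : Prop :=
  (∀ W Y : Finset X, 0 ≤ S W Y ∧ S W Y ≤ 1) ∧
  (∀ Y : Finset X, ∑ W : Finset X, S W Y = 1) ∧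
  (∀ W Y : Finset X, 0 < S W Y → W ⊆ Y) ∧
  (∀ W : Finset X, m₁ W = ∑ Y : Finset X, S W Y * m₂ Y)

/-- The specialization order `m₁ ≤_s m₂`. -/
def SpecOrder {X : Type*} [Fintype X] (m₁ m₂ : Finset X → ℝ) : Prop :=
  ∃ S : Finset X → Finset X → ℝ, IsSpecMatrix S m₁ m₂

/-- The quality function `q_m(Y) = Σ_{Y ⊆ Z} m(Z)`. -/
def quality {X : Type*} [Fintype X] (m : Finset X → ℝ) (Y : Finset X) : ℝ :=
  ∑ Z : Finset X, if Y ⊆ Z then m Z else 0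

/-- The plausibility function `pl_m(Y) = Σ_{Z ∩ Y ≠ ∅} m(Z)`. -/
def plausibility {X : Type*} [Fintype X] (m : Finset X → ℝ) (Y : Finset X) : ℝ :=
  ∑ Z : Finset X, if (Z ∩ Y).Nonempty then m Z else 0

/-- The unnormalized Dempster combination `(m₁ ∩_m m₂)(Y) = Σ_{Z₁ ∩ Z₂ = Y} m₁(Z₁)·m₂(Z₂)`. -/
def interComb {X : Type*} [Fintype X] (m₁ m₂ : Finset X → ℝ) (Y : Finset X) : ℝ :=
  ∑ Z : Finset X × Finset X, if Z.1 ∩ Z.2 = Y then m₁ Z.1 * m₂ Z.2 else 0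

/-- The disjunctive combination `(m₁ ∪_m m₂)(Y) = Σ_{Z₁ ∪ Z₂ = Y} m₁(Z₁)·m₂(Z₂)`. -/
def unionComb {X : Type*} [Fintype X] (m₁ m₂ : Finset X → ℝ) (Y : Finset X) : ℝ :=
  ∑ Z : Finset X × Finset X, if Z.1 ∪ Z.2 = Y then m₁ Z.1 * m₂ Z.2 else 0

/-- The combined agenda `(◇c)(Y) = Σ_{(Z_j) : ⋂_j Z_j = Y} Π_j m_j(Z_j)`,
for a finite nonempty index set of agents `ι`. -/
def diamondAgenda {ι X : Type*} [Fintype ι] [Fintype X] (m : ι → Finset X → ℝ)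
    (Y : Finset X) : ℝ :=
  ∑ Z : ι → Finset X,
    if (⋂ j, (Z j : Set X)) = (Y : Set X) then ∏ j, m j (Z j) else 0

/-- The distributed agenda `(▷c)(Y) = Σ_{(Z_j) : ⋃_j Z_j = Y} Π_j m_j(Z_j)`,
for a finite nonempty index set of agents `ι`. -/
def triangleAgenda {ι X : Type*} [Fintype ι] [Fintype X] (m : ι → Finset X → ℝ)
    (Y : Finset X) : ℝ :=
  ∑ Z : ι → Finset X,
    if (⋃ j, (Z j : Set X)) = (Y : Set X) then ∏ j, m j (Z j) else 0

end

/-- The extents generated by a set of features are monotone in that set. -/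
theorem IsExtent.mono {A X : Type*} {I : Set (A × X)} {Y Z : Set X} {B : Set A}
    (h : IsExtent I Y B) (hYZ : Y ⊆ Z) : IsExtent I Z B := by
  obtain ⟨Y', hY', rfl⟩ := h
  exact ⟨Y', hY'.trans hYZ, rfl⟩

/-- Summing the pushforward of a weight `w` along `u` over the sets satisfying `P` amounts to
summing `w` over the points whose image satisfies `P`. -/
theorem sum_ite_pushforward {α X : Type*} [Fintype α] [Fintype X] (u : α → Set X)
    (w : α → ℝ) (P : Set X → Prop) :
    (∑ Y : Finset X, if P (Y : Set X) then
      (∑ z : α, if u z = (Y : Set X) then w z else 0) else 0) =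
      ∑ z : α, if P (u z) then w z else 0 := by
  have key (Y : Finset X) : (if P (Y : Set X) then
      (∑ z : α, if u z = (Y : Set X) then w z else 0) else 0) =
      ∑ z : α, if Y = (u z).toFinset then (if P (u z) then w z else 0) else 0 := by
    by_cases hY : P (Y : Set X)
    · rw [if_pos hY]
      refine Finset.sum_congr rfl fun z _ => ?_
      by_cases h : u z = (Y : Set X)
      · simp [h, hY]
      · rw [if_neg h, if_neg fun h' => h (by simp [h'])]
    · rw [if_neg hY]
      refine (Finset.sum_eq_zero fun z _ => ?_).symm
      split_ifs with h h' <;> simp_all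
  simp only [key]
  rw [Finset.sum_comm]
  simp

/-- The `j`-th marginal of a product of weights of total mass one is the `j`-th weight. -/
theorem sum_apply_mul_prod {ι β : Type*} [Fintype ι] [Fintype β] (m : ι → β → ℝ)
    (hm : ∀ i, ∑ y, m i y = 1) (j : ι) (f : β → ℝ) :
    ∑ z : ι → β, f (z j) * ∏ i, m i (z i) = ∑ y, f y * m j y := by
  calc ∑ z : ι → β, f (z j) * ∏ i, m i (z i)
      = ∑ z : ι → β, ∏ i, (if i = j then f (z i) else 1) * m i (z i) := by
        simp only [Finset.prod_mul_distrib, Finset.prod_ite_eq', Finset.mem_univ, if_true]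
    _ = ∏ i, ∑ y, (if i = j then f y else 1) * m i y :=
        (Fintype.prod_sum fun i y => (if i = j then f y else 1) * m i y).symm
    _ = ∑ y, f y * m j y := by
        rw [Fintype.prod_eq_single j fun i hi => by simp [hi, hm]]
        simp

theorem stabilityIndex_eq_sum_prod {A ι X : Type*} [Fintype ι] [Fintype X]
    (I : Set (A × X)) (m : ι → Finset X → ℝ) (hm : ∀ j, IsMass (m j)) (j : ι) (G : Set A) :
    stabilityIndex I (m j) G =
      ∑ Z : ι → Finset X, if IsExtent I (Z j : Set X) G then ∏ i, m i (Z i) else 0 := by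
  simpa [stabilityIndex] using (sum_apply_mul_prod m (fun i => (hm i).2) j
    fun Y => if IsExtent I (Y : Set X) G then 1 else 0).symm

theorem sum_ite_le_sum_ite {α : Type*} [Fintype α] {w : α → ℝ} (hw : ∀ z, 0 ≤ w z)
    {p q : α → Prop} (hpq : ∀ z, p z → q z) :
    (∑ z, if p z then w z else 0) ≤ ∑ z, if q z then w z else 0 := by
  refine Finset.sum_le_sum fun z _ => ?_
  by_cases hp : p z
  · simp [hp, hpq z hp]
  · rw [if_neg hp]
    split_ifs
    exacts [hw z, le_rfl]

theorem stabilityIndex_diamondAgenda_le {A ι X : Type*} [Fintype ι] [Fintype X]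
    (I : Set (A × X)) (m : ι → Finset X → ℝ) (hm : ∀ j, IsMass (m j)) (j : ι) (G : Set A) :
    stabilityIndex I (diamondAgenda m) G ≤ stabilityIndex I (m j) G := by
  rw [stabilityIndex_eq_sum_prod I m hm]
  unfold stabilityIndex diamondAgenda
  rw [sum_ite_pushforward (fun Z : ι → Finset X => ⋂ j, (Z j : Set X)) _
    fun Y => IsExtent I Y G]
  exact sum_ite_le_sum_ite (fun Z => Finset.prod_nonneg fun i _ => ((hm i).1 _).1)
    fun Z h => h.mono (Set.iInter_subset _ j)

theorem stabilityIndex_le_triangleAgenda {A ι X : Type*} [Fintype ι] [Fintype X]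
    (I : Set (A × X)) (m : ι → Finset X → ℝ) (hm : ∀ j, IsMass (m j)) (j : ι) (G : Set A) :
    stabilityIndex I (m j) G ≤ stabilityIndex I (triangleAgenda m) G := by
  rw [stabilityIndex_eq_sum_prod I m hm]
  unfold stabilityIndex triangleAgenda
  rw [sum_ite_pushforward (fun Z : ι → Finset X => ⋃ j, (Z j : Set X)) _
    fun Y => IsExtent I Y G]
  exact sum_ite_le_sum_ite (fun Z => Finset.prod_nonneg fun i _ => ((hm i).1 _).1)
    fun Z h => h.mono (Set.subset_iUnion (fun i => (Z i : Set X)) j)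

theorem Csys_diamond_triangle {A ι X : Type*} [Fintype ι] [Nonempty ι] [Fintype X]
    (I : Set (A × X)) (m : ι → Finset X → ℝ) (hm : ∀ j, IsMass (m j)) (j : ι)
    (β : ℝ) (h0 : 0 ≤ β) (h1 : β ≤ 1) :
    Csys I (diamondAgenda m) β ⊆ Csys I (m j) β ∧
    Csys I (m j) β ⊆ Csys I (triangleAgenda m) β :=
  ⟨fun G hG => ⟨hG.1, hG.2.trans (stabilityIndex_diamondAgenda_le I m hm j G)⟩,
    fun G hG => ⟨hG.1, hG.2.trans (stabilityIndex_le_triangleAgenda I m hm j G)⟩⟩
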